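/- Let n ≥ 2 and t ≥ 2 be natural numbers and let q be a real number with 0 < q < 1. Then 1 − (1 − q)^t · C(n + t − 2, t) / (n − 1)^t > q, where C denotes the binomial coefficient. -/

import Mathlib

theorem choose_add_le_add_one_pow (k t : ℕ) : (k + t).choose t ≤ (k + 1) ^ t := by
  induction t with
  | zero => simp
  | succ t ih =>
    have h := Nat.add_one_mul_choose_eq (k + t) t
    refine Nat.le_of_mul_le_mul_right (c := t + 1) ?_ t.succ_pos
    calc (k + (t + 1)).choose (t + 1) * (t + 1)
        = (k + t + 1) * (k + t).choose t := h.symm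
      _ ≤ ((k + 1) * (t + 1)) * (k + 1) ^ t := Nat.mul_le_mul (by nlinarith [Nat.zero_le (k * t)]) ih
      _ = (k + 1) ^ (t + 1) * (t + 1) := by ring

/-- The prefix-walk refinement strictly increases the probability of classifying an
empty-answer query into bucket `B 1`:
`1 - (1 - q) ^ t * C(n + t - 2, t) / (n - 1) ^ t > q` for `n ≥ 2`, `t ≥ 2`, `0 < q < 1`. -/
theorem stmt_8 (n t : ℕ) (hn : 2 ≤ n) (ht : 2 ≤ t) (q : ℝ) (hq0 : 0 < q) (hq1 : q < 1) :
    1 - (1 - q) ^ t * ((n + t - 2).choose t : ℝ) / ((n : ℝ) - 1) ^ t > q := by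
  obtain ⟨k, rfl⟩ := Nat.exists_eq_add_of_le' hn
  have hchoose : (((k + 2 + t - 2).choose t : ℕ) : ℝ) ≤ ((k + 2 : ℕ) - 1 : ℝ) ^ t := by
    rw [show k + 2 + t - 2 = k + t by omega, show ((k + 2 : ℕ) - 1 : ℝ) = k + 1 by push_cast; ring]
    exact_mod_cast choose_add_le_add_one_pow k t
  have hpos : (0 : ℝ) < ((k + 2 : ℕ) - 1 : ℝ) ^ t := by
    apply pow_pos
    push_cast
    linarith [(k.cast_nonneg : (0 : ℝ) ≤ k)]
  have hle : (1 - q) ^ t * ((k + 2 + t - 2).choose t : ℝ) / ((k + 2 : ℕ) - 1 : ℝ) ^ t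
      ≤ (1 - q) ^ t := by
    rw [div_le_iff₀ hpos]
    exact mul_le_mul_of_nonneg_left hchoose (pow_nonneg (by linarith) t)
  have hlt : (1 - q) ^ t < 1 - q :=
    pow_lt_self_of_lt_one₀ (by linarith) (by linarith) (by omega)
  linarith
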